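/- Let φ : ℂ → ℂ² be an injective holomorphic immersion (φ' nowhere vanishing) and ψ : ℂ → ℂ² a nonconstant entire map with ψ(ℂ) ⊆ φ(ℂ), ψ(0) = φ(0), and such that every fiber ψ^{-1}(ψ(ζ)) has at most k points. Then there is a polynomial p of degree at most k with p(0) = 0 and ψ = φ ∘ p. -/

import Mathlib

open Filter Topology Set Metric Bornology

/-- **Generalized Liouville theorem**: an entire function of polynomial growth is a polynomial. -/
theorem Differentiable.exists_polynomial_of_isBigO_pow {f : ℂ → ℂ} (hf : Differentiable ℂ f)
    {m : ℕ} (hO : f =O[cobounded ℂ] fun z => z ^ m) :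
    ∃ q : Polynomial ℂ, ∀ z, f z = q.eval z := by
  induction m generalizing f with
  | zero =>
    have hb : IsBounded (range f) := by
      obtain ⟨C, hC⟩ := hO.bound
      obtain ⟨R, -, hR⟩ := (hasBasis_cobounded_compl_closedBall (0 : ℂ)).eventually_iff.1 hC
      refine (((isCompact_closedBall (0 : ℂ) R).image hf.continuous).isBounded.union
        (isBounded_closedBall (x := (0 : ℂ)) (r := C))).subset ?_
      rintro _ ⟨z, rfl⟩
      by_cases hz : z ∈ closedBall (0 : ℂ) R
      · exact Or.inl (mem_image_of_mem f hz)
      · exact Or.inr (by simpa using hR hz)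
    exact ⟨Polynomial.C (f 0), fun z => by simpa using hf.apply_eq_apply_of_bounded hb z 0⟩
  | succ m ih =>
    have hg : Differentiable ℂ (dslope f 0) := by
      rw [← differentiableOn_univ] at hf ⊢
      exact (Complex.differentiableOn_dslope univ_mem).2 hf
    have hgO : dslope f 0 =O[cobounded ℂ] fun z => z ^ m := by
      have hc : (fun _ : ℂ => f 0) =O[cobounded ℂ] fun z : ℂ => z ^ (m + 1) := by
        refine (Asymptotics.isBigO_const_const (f 0) (one_ne_zero (α := ℂ)) _).trans ?_
        simpa using Asymptotics.isBigO_pow_pow_cobounded_of_le (R := ℂ) (Nat.zero_le (m + 1))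
      have hmul := (Asymptotics.isBigO_refl (fun z : ℂ => z⁻¹) (cobounded ℂ)).mul (hO.sub hc)
      have hne : ∀ᶠ z : ℂ in cobounded ℂ, z ≠ 0 := eventually_ne_cobounded 0
      refine hmul.congr' ?_ ?_
      · filter_upwards [hne] with z hz
        simp [dslope_of_ne f hz, slope]
      · filter_upwards [hne] with z hz
        rw [pow_succ', inv_mul_cancel_left₀ hz]
    obtain ⟨q, hq⟩ := ih hg hgO
    refine ⟨Polynomial.C (f 0) + Polynomial.X * q, fun z => ?_⟩
    have h := sub_smul_dslope f 0 z
    simp only [sub_zero, smul_eq_mul] at h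
    simp [← hq, h]

/-- If an entire function omits a ball near infinity, then it is a polynomial. -/
theorem Differentiable.exists_polynomial_of_le_norm_sub {f : ℂ → ℂ} (hf : Differentiable ℂ f)
    {w : ℂ} {r : ℝ} (hr : 0 < r) (hw : ∀ᶠ z in cobounded ℂ, r ≤ ‖f z - w‖) :
    ∃ q : Polynomial ℂ, ∀ z, f z = q.eval z := by
  set G : ℂ → ℂ := fun u => (f u⁻¹ - w)⁻¹ with hG
  have hinv : ∀ᶠ u : ℂ in 𝓝[≠] 0, r ≤ ‖f u⁻¹ - w‖ := tendsto_inv₀_nhdsNE_zero.eventually hw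
  have hd : ∀ᶠ u in 𝓝[≠] 0, DifferentiableAt ℂ G u := by
    filter_upwards [hinv, self_mem_nhdsWithin] with u hu hu0
    have hne : f u⁻¹ - w ≠ 0 := norm_pos_iff.1 (hr.trans_le hu)
    exact (((hf _).comp u (differentiableAt_inv hu0)).sub_const w).inv hne
  have hb : IsBoundedUnder (· ≤ ·) (𝓝[≠] 0) fun u => ‖G u - G 0‖ := by
    refine isBoundedUnder_of_eventually_le (a := r⁻¹ + ‖G 0‖) ?_
    filter_upwards [hinv] with u hu
    refine (norm_sub_le _ _).trans (add_le_add_left ?_ _)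
    rw [hG, norm_inv]
    exact inv_anti₀ hr hu
  have hlim := Complex.tendsto_limUnder_of_differentiable_on_punctured_nhds_of_bounded_under hd hb
  set H : ℂ → ℂ := Function.update G 0 (limUnder (𝓝[≠] 0) G)
  have hHG : ∀ᶠ u in 𝓝[≠] 0, H u = G u := by
    filter_upwards [self_mem_nhdsWithin] with u hu
    exact Function.update_of_ne hu _ _
  have hHan : AnalyticAt ℂ H 0 := by
    refine Complex.analyticAt_of_differentiable_on_punctured_nhds_of_continuousAt ?_
      (continuousAt_update_same.2 hlim)
    filter_upwards [hd, self_mem_nhdsWithin] with u hu hu0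
    refine hu.congr_of_eventuallyEq ?_
    filter_upwards [isOpen_ne.mem_nhds hu0] with v hv
    exact Function.update_of_ne hv _ _
  have hHne : ¬∀ᶠ u in 𝓝 0, H u = 0 := by
    intro h
    obtain ⟨u, h1, h2, h3⟩ :=
      ((h.filter_mono nhdsWithin_le_nhds).and (hHG.and hinv)).exists (f := 𝓝[≠] (0 : ℂ))
    rw [h2, hG, inv_eq_zero] at h1
    rw [h1, norm_zero] at h3
    exact hr.not_ge h3
  obtain ⟨m, g, hg, hg0, hHg⟩ := hHan.exists_eventuallyEq_pow_smul_nonzero_iff.2 hHne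
  have hgb : ∀ᶠ u in 𝓝 0, ‖g 0‖ / 2 < ‖g u‖ :=
    hg.continuousAt.norm.eventually (lt_mem_nhds (half_lt_self (norm_pos_iff.2 hg0)))
  have hbound : ∀ᶠ u in 𝓝[≠] 0, ‖f u⁻¹ - w‖ ≤ 2 / ‖g 0‖ * ‖(u⁻¹) ^ m‖ := by
    filter_upwards [hHg.filter_mono nhdsWithin_le_nhds, hHG, hgb.filter_mono nhdsWithin_le_nhds,
      self_mem_nhdsWithin] with u h1 h2 h3 hu0
    have h4 : f u⁻¹ - w = (u ^ m * g u)⁻¹ := by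
      have h5 : (f u⁻¹ - w)⁻¹ = u ^ m * g u := by simpa [hG] using h2.symm.trans h1
      rw [← h5, inv_inv]
    have hpos : 0 < ‖g 0‖ := norm_pos_iff.2 hg0
    rw [h4, norm_inv, norm_mul, mul_inv, mul_comm, inv_pow, norm_inv]
    gcongr
    rw [← inv_div]
    exact inv_anti₀ (by positivity) h3.le
  have hO : (fun z => f z - w) =O[cobounded ℂ] fun z => z ^ m := by
    refine Asymptotics.IsBigO.of_bound (2 / ‖g 0‖) ?_
    simpa using tendsto_inv₀_cobounded'.eventually hbound
  obtain ⟨q, hq⟩ := (hf.sub_const w).exists_polynomial_of_isBigO_pow hO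
  exact ⟨q + Polynomial.C w, fun z => by simp [← hq]⟩

/-- An entire function with finite fibers is a polynomial. -/
theorem Differentiable.exists_polynomial_of_finite_fibers {f : ℂ → ℂ} (hf : Differentiable ℂ f)
    (hfin : ∀ w, (f ⁻¹' {w}).Finite) : ∃ q : Polynomial ℂ, ∀ z, f z = q.eval z := by
  have hopen : ∀ n : ℕ, IsOpen (f '' (closedBall 0 n)ᶜ) := by
    rcases (hf.differentiableOn.analyticOnNhd isOpen_univ).is_constant_or_isOpen
      isPreconnected_univ with ⟨w, hw⟩ | h
    · exact absurd (hfin w) (by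
        rw [show f ⁻¹' {w} = univ from eq_univ_of_forall fun z => hw z trivial]
        exact infinite_univ)
    · exact fun n => h _ (subset_univ _) isClosed_closedBall.isOpen_compl
  by_cases hdense : ∀ n : ℕ, Dense (f '' (closedBall 0 n)ᶜ)
  · obtain ⟨w, hw⟩ := (dense_iInter_of_isOpen_nat hopen hdense).nonempty
    obtain ⟨R, hR⟩ := (hfin w).isBounded.subset_closedBall 0
    obtain ⟨n, hn⟩ := exists_nat_ge R
    obtain ⟨z, hz, hzw⟩ := mem_iInter.1 hw n
    exact absurd (closedBall_subset_closedBall hn (hR hzw)) hz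
  · push Not at hdense
    obtain ⟨n, hn⟩ := hdense
    simp only [Metric.dense_iff, not_forall, not_nonempty_iff_eq_empty] at hn
    obtain ⟨w, r, hr, hwr⟩ := hn
    refine hf.exists_polynomial_of_le_norm_sub (w := w) hr ?_
    filter_upwards [isBounded_def.1 (isBounded_closedBall (x := (0 : ℂ)) (r := n))] with z hz
    by_contra! hlt
    exact (eq_empty_iff_forall_notMem.1 hwr) (f z)
      ⟨mem_ball_iff_norm.2 hlt, mem_image_of_mem f hz⟩

/-- Over an algebraically closed field of characteristic zero, a generic fiber of a polynomial has
as many points as its degree. -/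
theorem Polynomial.natDegree_le_of_card_fiber_le {K : Type*} [Field K] [IsAlgClosed K] [CharZero K]
    {q : Polynomial K} {k : ℕ}
    (h : ∀ ζ, ∃ s : Finset K, s.card ≤ k ∧ {ξ | q.eval ξ = q.eval ζ} ⊆ ↑s) :
    q.natDegree ≤ k := by
  classical
  rcases Nat.eq_zero_or_pos q.natDegree with h0 | hpos
  · omega
  have hder : q.derivative ≠ 0 := fun h' =>
    hpos.ne' (Polynomial.derivative_eq_zero.1 h')
  obtain ⟨w, hw⟩ := Infinite.exists_notMem_finset (q.derivative.roots.toFinset.image q.eval)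
  have hdeg : (q - C w).natDegree = q.natDegree := Polynomial.natDegree_sub_C
  have hne : q - C w ≠ 0 := by
    rintro h'
    rw [h', natDegree_zero] at hdeg
    omega
  have hnodup : (q - C w).roots.Nodup := by
    refine Polynomial.nodup_roots_iff_of_splits hne (IsAlgClosed.splits _) |>.2 ?_
    refine (isCoprime_of_dvd _ _ (by simp [hne]) ?_)
    intro z hz hz0 hzq hzd
    obtain ⟨x, hx⟩ := IsAlgClosed.exists_root z
      (fun hd => hz (Polynomial.isUnit_iff_degree_eq_zero.2 hd))
    have h1 : (q - C w).eval x = 0 := (hx.dvd hzq)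
    have h2 : (q - C w).derivative.eval x = 0 := (hx.dvd hzd)
    simp only [derivative_sub, derivative_C, sub_zero] at h2
    refine hw (Finset.mem_image.2 ⟨x, ?_, ?_⟩)
    · simpa [hder] using h2
    · simpa [sub_eq_zero] using h1
  obtain ⟨ζ, hζ⟩ := IsAlgClosed.exists_root (q - C w)
    (by rw [degree_eq_natDegree hne, hdeg]; exact_mod_cast hpos.ne')
  have hζw : q.eval ζ = w := by simpa [sub_eq_zero] using hζ
  obtain ⟨s, hs, hsub⟩ := h ζ
  calc q.natDegree = (q - C w).roots.card := by
        rw [← hdeg]; exact (IsAlgClosed.splits (q - C w)).natDegree_eq_card_roots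
    _ = (q - C w).roots.toFinset.card := (Multiset.toFinset_card_of_nodup hnodup).symm
    _ ≤ s.card := by
        refine Finset.card_le_card fun x hx => hsub ?_
        have : q.eval x = w := by simpa [hne, sub_eq_zero] using hx
        exact this.trans hζw.symm
    _ ≤ k := hs

section Lift

variable {E : Type*} [NormedAddCommGroup E] [NormedSpace ℂ E] {φ ψ : ℂ → E} {p : ℂ → ℂ}

/-- A lift through an injective immersion is analytic at every point near which it is frequently
bounded. -/
theorem analyticAt_lift_of_frequently_bounded [CompleteSpace E]
    (hφ : Differentiable ℂ φ) (hinj : Function.Injective φ) (himm : ∀ ζ, deriv φ ζ ≠ 0)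
    (hψ : Differentiable ℂ ψ) (hp : ∀ ζ, φ (p ζ) = ψ ζ) {ζ₀ : ℂ} {R : ℝ}
    (hR : ∃ᶠ ζ in 𝓝[≠] ζ₀, p ζ ∈ closedBall (0 : ℂ) R) : AnalyticAt ℂ p ζ₀ := by
  obtain ⟨w, -, hw⟩ := (isCompact_closedBall (0 : ℂ) R).exists_mapClusterPt_of_frequently hR
  have hφw : φ w = ψ ζ₀ := by
    have hlim : Tendsto (φ ∘ p) (𝓝[≠] ζ₀) (𝓝 (ψ ζ₀)) := by
      rw [show φ ∘ p = ψ from funext hp]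
      exact hψ.continuous.continuousAt.tendsto.mono_left nhdsWithin_le_nhds
    exact eq_of_nhds_neBot ((hw.continuousAt_comp hφ.continuous.continuousAt).clusterPt.mono hlim)
  obtain ⟨L, hL⟩ := SeparatingDual.exists_ne_zero (R := ℂ) (himm w)
  have hLφ : AnalyticAt ℂ (fun z => L (φ z)) w := (L.differentiable.comp hφ).analyticAt w
  have hLd : deriv (fun z => L (φ z)) w ≠ 0 :=
    (L.hasFDerivAt.comp_hasDerivAt w (hφ w).hasDerivAt).deriv.trans_ne hL
  have hσ := hLφ.analyticAt_localInverse hLd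
  have hleft := (hLφ.hasStrictDerivAt.hasStrictFDerivAt_equiv hLd).eventually_left_inverse
  change ∀ᶠ z in 𝓝 w, hLφ.hasStrictDerivAt.localInverse _ _ _ hLd (L (φ z)) = z at hleft
  set σ := hLφ.hasStrictDerivAt.localInverse _ _ _ hLd
  have hP : AnalyticAt ℂ (fun ζ => σ (L (ψ ζ))) ζ₀ := by
    refine AnalyticAt.fun_comp (g := σ) ?_ ((L.differentiable.comp hψ).analyticAt ζ₀)
    simpa only [Function.comp, ← hφw] using hσ
  have hfreq : ∃ᶠ ζ in 𝓝[≠] ζ₀, φ (σ (L (ψ ζ))) = ψ ζ := by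
    refine (hw.frequently hleft).mono fun ζ h => ?_
    rw [hp] at h
    rw [h, hp]
  have hev := (((hφ.analyticAt _).fun_comp hP).frequently_eq_iff_eventually_eq
    (hψ.analyticAt ζ₀)).1 hfreq
  exact hP.congr (hev.mono fun ζ h => hinj (h.trans (hp ζ).symm))

/-- A lift of an entire curve through an injective immersion has no isolated singularity at which
it tends to infinity. -/
theorem not_tendsto_cobounded_lift
    (hφ : Differentiable ℂ φ) (hinj : Function.Injective φ)
    (hψ : Differentiable ℂ ψ) (hp : ∀ ζ, φ (p ζ) = ψ ζ) {ζ₀ : ℂ}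
    (han : ∀ᶠ ζ in 𝓝[≠] ζ₀, AnalyticAt ℂ p ζ) : ¬Tendsto p (𝓝[≠] ζ₀) (cobounded ℂ) := by
  intro hlim
  set g : ℂ → ℂ := Function.update (fun ζ => (p ζ)⁻¹) ζ₀ 0
  have hg0 : g ζ₀ = 0 := Function.update_self ..
  have hgne : ∀ ζ, ζ ≠ ζ₀ → g ζ = (p ζ)⁻¹ := fun ζ h => Function.update_of_ne h _ _
  have hpne : ∀ᶠ ζ in 𝓝[≠] ζ₀, p ζ ≠ 0 := hlim.eventually (eventually_ne_cobounded 0)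
  have hgan : AnalyticAt ℂ g ζ₀ := by
    refine Complex.analyticAt_of_differentiable_on_punctured_nhds_of_continuousAt ?_
      (continuousAt_update_same.2 (tendsto_inv₀_cobounded.comp hlim))
    filter_upwards [han, hpne, self_mem_nhdsWithin] with ζ h1 h2 h3
    refine (h1.differentiableAt.inv h2).congr_of_eventuallyEq ?_
    filter_upwards [isOpen_ne.mem_nhds h3] with ξ hξ using hgne ξ hξ
  have hopen : 𝓝 0 ≤ map g (𝓝 ζ₀) := by
    rw [← hg0]
    refine hgan.eventually_constant_or_nhds_le_map_nhds.resolve_left fun hconst => ?_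
    obtain ⟨ζ, h1, h2, h3⟩ := ((hconst.filter_mono nhdsWithin_le_nhds).and
      (hpne.and self_mem_nhdsWithin)).exists (f := 𝓝[≠] ζ₀)
    rw [hgne ζ h3, hg0, inv_eq_zero] at h1
    exact h2 h1
  have hbdd : ∀ᶠ w in cobounded ℂ, φ w ∈ ball (ψ ζ₀) 1 := by
    have hball : ∀ᶠ ζ in 𝓝 ζ₀, ψ ζ ∈ ball (ψ ζ₀) 1 :=
      hψ.continuous.continuousAt.eventually_mem (ball_mem_nhds _ one_pos)
    have himg : g '' {ζ | ψ ζ ∈ ball (ψ ζ₀) 1} ∈ 𝓝 0 := hopen (image_mem_map hball)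
    filter_upwards [tendsto_inv₀_cobounded.eventually_mem himg, eventually_ne_cobounded 0]
      with w ⟨ζ, hζ, hζw⟩ hw
    have hne : ζ ≠ ζ₀ := by
      rintro rfl
      exact hw (inv_eq_zero.1 (hζw.symm.trans hg0))
    rw [hgne ζ hne, inv_inj] at hζw
    rw [← hζw, hp]
    exact hζ
  obtain ⟨R, -, hR⟩ := (hasBasis_cobounded_compl_closedBall (0 : ℂ)).eventually_iff.1 hbdd
  have hrange : IsBounded (range φ) := by
    refine (((isCompact_closedBall (0 : ℂ) R).image hφ.continuous).isBounded.union
      (isBounded_ball (x := ψ ζ₀) (r := 1))).subset ?_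
    rintro _ ⟨z, rfl⟩
    by_cases hz : z ∈ closedBall (0 : ℂ) R
    · exact Or.inl (mem_image_of_mem φ hz)
    · exact Or.inr (hR hz)
  exact zero_ne_one (hinj (hφ.apply_eq_apply_of_bounded hrange 0 1))

/-- A lift of an entire curve through an injective immersion is entire. -/
theorem differentiable_lift [CompleteSpace E]
    (hφ : Differentiable ℂ φ) (hinj : Function.Injective φ) (himm : ∀ ζ, deriv φ ζ ≠ 0)
    (hψ : Differentiable ℂ ψ) (hp : ∀ ζ, φ (p ζ) = ψ ζ) : Differentiable ℂ p := by
  set S : Set ℂ := {ζ | AnalyticAt ℂ p ζ}ᶜ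
  have hS : IsClosed S := (isOpen_analyticAt ℂ p).isClosed_compl
  suffices h : S = ∅ from fun ζ => (not_not.1 (eq_empty_iff_forall_notMem.1 h ζ)).differentiableAt
  by_contra hne
  have : Nonempty S := (nonempty_iff_ne_empty.2 hne).to_subtype
  have : CompleteSpace S := hS.completeSpace_coe
  have hlevel : ∀ n : ℕ, p ⁻¹' closedBall 0 n = ψ ⁻¹' (φ '' closedBall 0 n) := fun n => by
    ext ζ
    rw [mem_preimage, mem_preimage, ← hp, hinj.mem_set_image]
  have hclosed : ∀ n : ℕ, IsClosed ((↑) ⁻¹' (p ⁻¹' closedBall 0 n) : Set S) := fun n => by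
    rw [hlevel]
    exact ((((isCompact_closedBall (0 : ℂ) n).image hφ.continuous).isClosed).preimage
      hψ.continuous).preimage continuous_subtype_val
  have hcover : ⋃ n : ℕ, ((↑) ⁻¹' (p ⁻¹' closedBall 0 n) : Set S) = univ :=
    eq_univ_of_forall fun x => by
      obtain ⟨n, hn⟩ := exists_nat_ge ‖p x‖
      exact mem_iUnion.2 ⟨n, by simpa using hn⟩
  obtain ⟨n, ⟨ζ₀, hζ₀⟩, hint⟩ := nonempty_interior_of_iUnion_of_closed hclosed hcover
  have hunbdd : ∀ R : ℝ, ∀ᶠ ζ in 𝓝[≠] ζ₀, p ζ ∉ closedBall (0 : ℂ) R := fun R => by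
    by_contra h
    exact hζ₀ (analyticAt_lift_of_frequently_bounded hφ hinj himm hψ hp h)
  have hiso : ∀ᶠ ζ in 𝓝[≠] ζ₀, AnalyticAt ℂ p ζ := by
    rw [mem_interior_iff_mem_nhds, mem_nhds_subtype] at hint
    obtain ⟨u, hu, hsub⟩ := hint
    filter_upwards [hunbdd n, nhdsWithin_le_nhds hu] with ζ h1 h2
    by_contra h3
    exact h1 (hsub (a := ⟨ζ, h3⟩) h2)
  refine not_tendsto_cobounded_lift hφ hinj hψ hp hiso ?_
  exact (hasBasis_cobounded_compl_closedBall (0 : ℂ)).tendsto_right_iff.2 fun R _ => hunbdd R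

end Lift


/-- Lemma 6.5: if `φ : ℂ → ℂ²` is an injective holomorphic immersion and
`ψ : ℂ → ℂ²` is a nonconstant entire map with `ψ(ℂ) ⊆ φ(ℂ)`, `ψ(0) = φ(0)`, and
fibers of cardinality at most `k`, then `ψ = φ ∘ p` for a polynomial `p` of
degree at most `k` with `p(0) = 0`. -/
theorem stmt12 (φ ψ : ℂ → ℂ × ℂ) (k : ℕ) (hk : 1 ≤ k)
    (hφd : Differentiable ℂ φ) (hφinj : Function.Injective φ)
    (hφimm : ∀ ζ, deriv φ ζ ≠ 0)
    (hψd : Differentiable ℂ ψ) (hψnc : ∃ a b : ℂ, ψ a ≠ ψ b)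
    (hrange : Set.range ψ ⊆ Set.range φ) (h0 : ψ 0 = φ 0)
    (hfib : ∀ ζ : ℂ, ∃ s : Finset ℂ, s.card ≤ k ∧ {ξ : ℂ | ψ ξ = ψ ζ} ⊆ ↑s) :
    ∃ q : Polynomial ℂ, q.natDegree ≤ k ∧ q.eval 0 = 0 ∧
      ∀ ζ, ψ ζ = φ (q.eval ζ) := by
  choose p hp using fun ζ => hrange (mem_range_self ζ)
  have hpd : Differentiable ℂ p := differentiable_lift hφd hφinj hφimm hψd hp
  have hfib' : ∀ ζ, ∃ s : Finset ℂ, s.card ≤ k ∧ {ξ | p ξ = p ζ} ⊆ ↑s := fun ζ => by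
    obtain ⟨s, hs, hsub⟩ := hfib ζ
    exact ⟨s, hs, fun ξ hξ => hsub (by rw [mem_ofPred_eq, ← hp, ← hp, hξ])⟩
  obtain ⟨q, hq⟩ := hpd.exists_polynomial_of_finite_fibers fun w => by
    rcases (p ⁻¹' {w}).eq_empty_or_nonempty with h | ⟨ζ, rfl⟩
    · exact h ▸ finite_empty
    · obtain ⟨s, -, hsub⟩ := hfib' ζ
      exact s.finite_toSet.subset hsub
  refine ⟨q, Polynomial.natDegree_le_of_card_fiber_le fun ζ => ?_, ?_, fun ζ => ?_⟩
  · simpa only [← hq] using hfib' ζ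
  · exact hφinj (by rw [← hq, hp, h0])
  · rw [← hq, hp]
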